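/- arXiv:2105.13636 — 8 statements merged into one kernel-verified Lean document; each statement's English description precedes it below -/
import Mathlib

section
/- Theorem 4.2 (the cost-sensitive LSEL is guess-averse): Let C be a cost matrix whose off-diagonal entries are constant within each row, i.e. C_{kl} = c_k for all l ≠ k (the cost-matrix conditions then force c_k > 0 for every k). Define the cost-sensitive LSEL pointwise loss ℓ(s, k; C) := c_k · log(1 + Σ_{l≠k} exp(−(s_k − s_l))) for s ∈ ℝ^K and k ∈ [K]. Then ℓ is guess-averse: for every k ∈ [K], every s ∈ S_k, every s' ∈ A, and every such cost matrix C, one has c_k · log(1 + Σ_{l≠k} exp(−(s_k − s_l))) < c_k · log(1 + Σ_{l≠k} exp(−(s'_k − s'_l))) = c_k · log K. -/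
open Finset

/-- Theorem 4.2: the cost-sensitive LSEL is guess-averse. -/
theorem clsel_guess_averse (K : ℕ) (hK : 2 ≤ K)
    (C : Fin K → Fin K → ℝ) (c : Fin K → ℝ)
    (hCnonneg : ∀ k l, 0 ≤ C k l) (hCdiag : ∀ k, C k k = 0)
    (hCrow : ∀ k, ∃ l, 0 < C k l)
    (hCconst : ∀ k l, l ≠ k → C k l = c k)
    (k : Fin K) (s s' : Fin K → ℝ)
    (hs : ∀ l, l ≠ k → s l < s k)
    (hs' : ∀ i j, s' i = s' j) :
    c k * Real.log (1 + ∑ l ∈ univ.filter (· ≠ k), Real.exp (-(s k - s l))) <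
      c k * Real.log (1 + ∑ l ∈ univ.filter (· ≠ k), Real.exp (-(s' k - s' l))) ∧
    c k * Real.log (1 + ∑ l ∈ univ.filter (· ≠ k), Real.exp (-(s' k - s' l))) =
      c k * Real.log K := by
  have hcpos : 0 < c k := by
    obtain ⟨l, hl⟩ := hCrow k
    have hlk : l ≠ k := by
      rintro rfl
      exact hl.ne' (hCdiag l)
    rwa [hCconst k l hlk] at hl
  have hguess : 1 + ∑ l ∈ univ.filter (· ≠ k), Real.exp (-(s' k - s' l)) = K := by
    have hexp : ∀ l, Real.exp (-(s' k - s' l)) = 1 := fun l => by simp [hs' k l]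
    simp only [hexp, filter_ne', sum_const, nsmul_eq_mul, mul_one,
      card_erase_of_mem (mem_univ k), card_univ, Fintype.card_fin]
    rw [Nat.cast_sub (by omega)]
    simp
  refine ⟨mul_lt_mul_of_pos_left (Real.log_lt_log (by positivity) ?_) hcpos, by rw [hguess]⟩
  have : Nontrivial (Fin K) := Fin.nontrivial_iff_two_le.mpr hK
  obtain ⟨m, hm⟩ := exists_ne k
  gcongr 1 + ?_
  refine sum_lt_sum_of_nonempty ⟨m, by simpa using hm⟩ fun l hl => Real.exp_lt_exp.mpr ?_
  linarith [hs l (mem_filter.mp hl).2, hs' k l]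
end

section
/- Theorem (the LSCEL is guess-averse): Define the pointwise loss ℓ(s, k; C) := log(1 + Σ_{l≠k} C_{kl} · exp(−(s_k − s_l))) for s ∈ ℝ^K, k ∈ [K], and C a cost matrix. Then ℓ is guess-averse: for every k ∈ [K], every s ∈ S_k, every s' ∈ A, and every cost matrix C, log(1 + Σ_{l≠k} C_{kl} · exp(−(s_k − s_l))) < log(1 + Σ_{l≠k} C_{kl} · exp(−(s'_k − s'_l))) = log(1 + Σ_{l≠k} C_{kl}). -/
open Finset

/-- The LSCEL is guess-averse. -/
theorem lscel_guess_averse (K : ℕ) (hK : 2 ≤ K)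
    (C : Fin K → Fin K → ℝ)
    (hCnonneg : ∀ k l, 0 ≤ C k l) (hCdiag : ∀ k, C k k = 0)
    (hCrow : ∀ k, ∃ l, 0 < C k l)
    (k : Fin K) (s s' : Fin K → ℝ)
    (hs : ∀ l, l ≠ k → s l < s k)
    (hs' : ∀ i j, s' i = s' j) :
    Real.log (1 + ∑ l ∈ univ.filter (· ≠ k), C k l * Real.exp (-(s k - s l))) <
      Real.log (1 + ∑ l ∈ univ.filter (· ≠ k), C k l * Real.exp (-(s' k - s' l))) ∧
    Real.log (1 + ∑ l ∈ univ.filter (· ≠ k), C k l * Real.exp (-(s' k - s' l))) =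
      Real.log (1 + ∑ l ∈ univ.filter (· ≠ k), C k l) := by
  have guess_eq : ∑ l ∈ univ.filter (· ≠ k), C k l * Real.exp (-(s' k - s' l)) =
      ∑ l ∈ univ.filter (· ≠ k), C k l :=
    sum_congr rfl fun l _ => by simp [hs' k l]
  refine ⟨?_, by rw [guess_eq]⟩
  rw [guess_eq]
  obtain ⟨m, hm⟩ := hCrow k
  have hmk : m ≠ k := by
    rintro rfl
    exact hm.ne' (hCdiag m)
  have weighted_nonneg : 0 ≤ ∑ l ∈ univ.filter (· ≠ k), C k l * Real.exp (-(s k - s l)) :=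
    sum_nonneg fun l _ => mul_nonneg (hCnonneg k l) (Real.exp_nonneg _)
  have exp_lt_one : ∀ l, l ≠ k → Real.exp (-(s k - s l)) < 1 := fun l hl =>
    Real.exp_lt_one_iff.mpr (by linarith [hs l hl])
  have sum_lt : ∑ l ∈ univ.filter (· ≠ k), C k l * Real.exp (-(s k - s l)) <
      ∑ l ∈ univ.filter (· ≠ k), C k l :=
    sum_lt_sum
      (fun l hl => mul_le_of_le_one_right (hCnonneg k l)
        (exp_lt_one l (mem_filter.mp hl).2).le)
      ⟨m, by simp [hmk], mul_lt_of_lt_one_right hm (exp_lt_one m hmk)⟩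
  exact Real.log_lt_log (by linarith) (by linarith)
end

section
/- Theorem (the cost-sensitive logistic loss ℓ_{C-logistic} is guess-averse): Define the pointwise loss ℓ(s, k; C) := (1/(K−1)) · Σ_{l≠k} C_{kl} · log(1 + exp(−(s_k − s_l))) for s ∈ ℝ^K, k ∈ [K], and C a cost matrix. Then ℓ is guess-averse: for every k ∈ [K], every s ∈ S_k, every s' ∈ A, and every cost matrix C, (1/(K−1)) Σ_{l≠k} C_{kl} log(1 + exp(−(s_k − s_l))) < (1/(K−1)) Σ_{l≠k} C_{kl} log(1 + exp(−(s'_k − s'_l))) = (1/(K−1)) Σ_{l≠k} C_{kl} log 2. -/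
open Finset

/-- The cost-sensitive logistic loss is guess-averse. -/
theorem c_logistic_guess_averse (K : ℕ) (hK : 2 ≤ K)
    (C : Fin K → Fin K → ℝ)
    (hCnonneg : ∀ k l, 0 ≤ C k l) (hCdiag : ∀ k, C k k = 0)
    (hCrow : ∀ k, ∃ l, 0 < C k l)
    (k : Fin K) (s s' : Fin K → ℝ)
    (hs : ∀ l, l ≠ k → s l < s k)
    (hs' : ∀ i j, s' i = s' j) :
    (1 / ((K : ℝ) - 1)) * ∑ l ∈ univ.filter (· ≠ k),
        C k l * Real.log (1 + Real.exp (-(s k - s l))) <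
      (1 / ((K : ℝ) - 1)) * ∑ l ∈ univ.filter (· ≠ k),
        C k l * Real.log (1 + Real.exp (-(s' k - s' l))) ∧
    (1 / ((K : ℝ) - 1)) * ∑ l ∈ univ.filter (· ≠ k),
        C k l * Real.log (1 + Real.exp (-(s' k - s' l))) =
      (1 / ((K : ℝ) - 1)) * ∑ l ∈ univ.filter (· ≠ k), C k l * Real.log 2 := by
  have guess_term : ∀ l, Real.log (1 + Real.exp (-(s' k - s' l))) = Real.log 2 := fun l => by
    rw [hs' k l, sub_self, neg_zero, Real.exp_zero, one_add_one_eq_two]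
  have support_term : ∀ l, l ≠ k → Real.log (1 + Real.exp (-(s k - s l))) < Real.log 2 := by
    intro l hl
    have hexp : Real.exp (-(s k - s l)) < 1 := Real.exp_lt_one_iff.mpr (by linarith [hs l hl])
    exact Real.log_lt_log (by positivity) (by linarith)
  have hK' : (0 : ℝ) < 1 / ((K : ℝ) - 1) := by
    have : (2 : ℝ) ≤ K := by exact_mod_cast hK
    exact one_div_pos.mpr (by linarith)
  simp only [guess_term, and_true]
  refine mul_lt_mul_of_pos_left (sum_lt_sum (fun l hl => ?_) ?_) hK'
  · exact mul_le_mul_of_nonneg_left (support_term l (mem_filter.mp hl).2).le (hCnonneg k l)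
  · obtain ⟨l, hl⟩ := hCrow k
    have hlk : l ≠ k := by
      rintro rfl
      exact hl.ne' (hCdiag l)
    exact ⟨l, mem_filter.mpr ⟨mem_univ l, hlk⟩, mul_lt_mul_of_pos_left (support_term l hlk) hl⟩
end

section
/- Theorem (the loss ℓ_{logistic-C} is guess-averse): Define the pointwise loss ℓ(s, k; C) := (1/(K−1)) · Σ_{l≠k} log(1 + C_{kl} · exp(−(s_k − s_l))) for s ∈ ℝ^K, k ∈ [K], and C a cost matrix. Then ℓ is guess-averse: for every k ∈ [K], every s ∈ S_k, every s' ∈ A, and every cost matrix C, (1/(K−1)) Σ_{l≠k} log(1 + C_{kl} exp(−(s_k − s_l))) < (1/(K−1)) Σ_{l≠k} log(1 + C_{kl} exp(−(s'_k − s'_l))) = (1/(K−1)) Σ_{l≠k} log(1 + C_{kl}). -/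
open Finset

/-- The loss ℓ_{logistic-C} is guess-averse. -/
theorem logistic_c_guess_averse (K : ℕ) (hK : 2 ≤ K)
    (C : Fin K → Fin K → ℝ)
    (hCnonneg : ∀ k l, 0 ≤ C k l) (hCdiag : ∀ k, C k k = 0)
    (hCrow : ∀ k, ∃ l, 0 < C k l)
    (k : Fin K) (s s' : Fin K → ℝ)
    (hs : ∀ l, l ≠ k → s l < s k)
    (hs' : ∀ i j, s' i = s' j) :
    (1 / ((K : ℝ) - 1)) * ∑ l ∈ univ.filter (· ≠ k),
        Real.log (1 + C k l * Real.exp (-(s k - s l))) <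
      (1 / ((K : ℝ) - 1)) * ∑ l ∈ univ.filter (· ≠ k),
        Real.log (1 + C k l * Real.exp (-(s' k - s' l))) ∧
    (1 / ((K : ℝ) - 1)) * ∑ l ∈ univ.filter (· ≠ k),
        Real.log (1 + C k l * Real.exp (-(s' k - s' l))) =
      (1 / ((K : ℝ) - 1)) * ∑ l ∈ univ.filter (· ≠ k), Real.log (1 + C k l) := by
  have hK' : (0 : ℝ) < 1 / ((K : ℝ) - 1) := by
    have : (2 : ℝ) ≤ K := by exact_mod_cast hK
    exact one_div_pos.2 (by linarith)
  have hguess : ∀ l, C k l * Real.exp (-(s' k - s' l)) = C k l := fun l => by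
    simp [hs' k l]
  have hexp : ∀ l, l ≠ k → Real.exp (-(s k - s l)) < 1 := fun l hl =>
    Real.exp_lt_one_iff.2 (by linarith [hs l hl])
  have hpos : ∀ l, 0 < 1 + C k l * Real.exp (-(s k - s l)) := fun l => by
    have := mul_nonneg (hCnonneg k l) (Real.exp_pos (-(s k - s l))).le
    linarith
  simp only [hguess, and_true]
  refine mul_lt_mul_of_pos_left (Finset.sum_lt_sum (fun l hl => ?_) ?_) hK'
  · have hlk := (mem_filter.1 hl).2
    refine Real.log_le_log (hpos l) ?_
    have := mul_le_of_le_one_right (hCnonneg k l) (hexp l hlk).le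
    linarith
  · obtain ⟨l, hl⟩ := hCrow k
    have hlk : l ≠ k := by
      rintro rfl
      exact hl.ne' (hCdiag l)
    refine ⟨l, mem_filter.2 ⟨mem_univ l, hlk⟩, Real.log_lt_log (hpos l) ?_⟩
    have := mul_lt_of_lt_one_right hl (hexp l hlk)
    linarith
end

section
/- Lemma (product-form guess-averse losses): Let γ : ℝ → ℝ be strictly increasing and let φ : ℝ → ℝ be nonnegative and satisfy φ(v) < φ(0) for every v > 0. Then the loss ℓ(s, y; C) := γ( ∏_{l∈[K]} (1 + C_{yl} · φ(s_y − s_l)) ) is guess-averse: for every k ∈ [K], every s ∈ S_k, every s' ∈ A, and every cost matrix C, γ( ∏_{l∈[K]} (1 + C_{kl} φ(s_k − s_l)) ) < γ( ∏_{l∈[K]} (1 + C_{kl} φ(0)) ) = ℓ(s', k; C). -/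
open Finset

/-- Product-form guess-averse losses (Lemma, Appendix G). -/
theorem product_form_guess_averse (K : ℕ) (hK : 2 ≤ K)
    (γ : ℝ → ℝ) (hγ : StrictMono γ)
    (φ : ℝ → ℝ) (hφ0 : ∀ v, 0 ≤ φ v) (hφ : ∀ v, 0 < v → φ v < φ 0)
    (C : Fin K → Fin K → ℝ)
    (hCnonneg : ∀ k l, 0 ≤ C k l) (hCdiag : ∀ k, C k k = 0)
    (hCrow : ∀ k, ∃ l, 0 < C k l)
    (k : Fin K) (s s' : Fin K → ℝ)
    (hs : ∀ l, l ≠ k → s l < s k)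
    (hs' : ∀ i j, s' i = s' j) :
    γ (∏ l, (1 + C k l * φ (s k - s l))) < γ (∏ l, (1 + C k l * φ 0)) ∧
    γ (∏ l, (1 + C k l * φ 0)) = γ (∏ l, (1 + C k l * φ (s' k - s' l))) := by
  refine ⟨hγ ?_, ?_⟩
  · obtain ⟨m, hm⟩ := hCrow k
    have hmk : m ≠ k := by
      rintro rfl
      exact hm.ne' (hCdiag m)
    refine Finset.prod_lt_prod (fun l _ => ?_) (fun l _ => ?_) ⟨m, Finset.mem_univ m, ?_⟩
    · have := mul_nonneg (hCnonneg k l) (hφ0 (s k - s l))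
      linarith
    · rcases eq_or_ne l k with rfl | hl
      · simp
      · have := mul_le_mul_of_nonneg_left (hφ _ (sub_pos.2 (hs l hl))).le (hCnonneg k l)
        linarith
    · have := mul_lt_mul_of_pos_left (hφ _ (sub_pos.2 (hs m hmk))) hm
      linarith
  · simp only [sub_eq_zero.2 (hs' k _)]
end

section
/- Lemma (sum-form guess-averse losses): Let γ : ℝ → ℝ be strictly increasing and let φ : ℝ → ℝ satisfy φ(v) < φ(0) for every v > 0. Then the loss ℓ(s, y; C) := γ( Σ_{k∈[K]} C_{yk} · φ(s_y − s_k) ) is guess-averse: for every k ∈ [K], every s ∈ S_k, every s' ∈ A, and every cost matrix C, γ( Σ_{l∈[K]} C_{kl} φ(s_k − s_l) ) < γ( Σ_{l∈[K]} C_{kl} φ(0) ) = ℓ(s', k; C). -/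
open Finset

/-- Sum-form guess-averse losses (Lemma 1 of Beijbom et al., Appendix G). -/
theorem sum_form_guess_averse (K : ℕ) (hK : 2 ≤ K)
    (γ : ℝ → ℝ) (hγ : StrictMono γ)
    (φ : ℝ → ℝ) (hφ : ∀ v, 0 < v → φ v < φ 0)
    (C : Fin K → Fin K → ℝ)
    (hCnonneg : ∀ k l, 0 ≤ C k l) (hCdiag : ∀ k, C k k = 0)
    (hCrow : ∀ k, ∃ l, 0 < C k l)
    (k : Fin K) (s s' : Fin K → ℝ)
    (hs : ∀ l, l ≠ k → s l < s k)
    (hs' : ∀ i j, s' i = s' j) :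
    γ (∑ l, C k l * φ (s k - s l)) < γ (∑ l, C k l * φ 0) ∧
    γ (∑ l, C k l * φ 0) = γ (∑ l, C k l * φ (s' k - s' l)) := by
  refine ⟨hγ (Finset.sum_lt_sum (fun l _ => ?_) ?_), ?_⟩
  · rcases eq_or_ne l k with rfl | hl
    · simp
    · exact mul_le_mul_of_nonneg_left (hφ _ (sub_pos.2 (hs l hl))).le (hCnonneg k l)
  · obtain ⟨l, hl⟩ := hCrow k
    have hlk : l ≠ k := by
      rintro rfl
      exact hl.ne' (hCdiag l)
    exact ⟨l, Finset.mem_univ l, mul_lt_mul_of_pos_left (hφ _ (sub_pos.2 (hs l hlk))) hl⟩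
  · simp only [sub_eq_zero.2 (hs' k _)]
end

section
/- Lemma D.1, minimization part (non-parametric estimation for the LSEL): Let (X, 𝔐, μ) be a measure space, K ≥ 2, and p_1,…,p_K : X → [0,∞) measurable probability densities with common support (p_k(x) = 0 ⟺ p_l(x) = 0 for all k, l, x). Then for every measurable score function s : X → ℝ^K, (1/K) Σ_{k=1}^{K} ∫_{{p_k>0}} p_k(x) · log( (Σ_{l=1}^{K} p_l(x)) / p_k(x) ) dμ(x) ≤ (1/K) Σ_{k=1}^{K} ∫ p_k(x) · log( 1 + Σ_{l≠k} exp(s_l(x) − s_k(x)) ) dμ(x); i.e., among all candidate log-likelihood-ratio matrices λ̃_{kl} = s_k − s_l, the LSEL functional is minimized by the true LLR matrix λ_{kl}(x) = log(p_k(x)/p_l(x)). -/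
open Finset MeasureTheory
open scoped ENNReal

/-- The softmax denominator: `1 + ∑_{l ≠ k} exp (t l - t k) = (∑ l, exp (t l)) / exp (t k)`. -/
theorem one_add_sum_exp_sub {ι : Type*} [Fintype ι] [DecidableEq ι] (t : ι → ℝ) (k : ι) :
    1 + ∑ l ∈ univ.filter (· ≠ k), Real.exp (t l - t k) =
      (∑ l, Real.exp (t l)) / Real.exp (t k) := by
  rw [Finset.filter_ne', Finset.sum_div, ← Finset.add_sum_erase _ _ (mem_univ k)]
  simp [Real.exp_sub]

/-- Gibbs' inequality for unnormalized weights. -/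
theorem sum_mul_log_sum_div_le {ι : Type*} [Fintype ι] (a b : ι → ℝ)
    (ha : ∀ k, 0 ≤ a k) (hb : ∀ k, 0 < b k) :
    ∑ k, a k * Real.log ((∑ l, a l) / a k) ≤ ∑ k, a k * Real.log ((∑ l, b l) / b k) := by
  rcases isEmpty_or_nonempty ι with h | h
  · simp
  set A := ∑ l, a l with hA
  set B := ∑ l, b l with hB
  have hBpos : 0 < B := Finset.sum_pos (fun k _ => hb k) univ_nonempty
  have hA0 : 0 ≤ A := Finset.sum_nonneg fun k _ => ha k
  have hterm (k : ι) :
      a k * Real.log (A / a k) ≤ a k * Real.log (B / b k) + (A * (b k / B) - a k) := by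
    rcases (ha k).eq_or_lt with h0 | h0
    · have := (hb k).le
      rw [← h0]
      simp only [zero_mul, zero_add, sub_zero]
      positivity
    · have hApos : 0 < A := h0.trans_le (Finset.single_le_sum (fun l _ => ha l) (mem_univ k))
      have hbk := hb k
      have hlog : Real.log (A / a k) - Real.log (B / b k) ≤ A / a k / (B / b k) - 1 := by
        rw [← Real.log_div (by positivity) (by positivity)]
        exact Real.log_le_sub_one_of_pos (by positivity)
      have hmul := mul_le_mul_of_nonneg_left hlog h0.le
      have heq : a k * (A / a k / (B / b k) - 1) = A * (b k / B) - a k := by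
        field_simp
      linarith
  calc ∑ k, a k * Real.log (A / a k)
      ≤ ∑ k, (a k * Real.log (B / b k) + (A * (b k / B) - a k)) :=
        Finset.sum_le_sum fun k _ => hterm k
    _ = ∑ k, a k * Real.log (B / b k) := by
        rw [Finset.sum_add_distrib, Finset.sum_sub_distrib, ← Finset.mul_sum, ← Finset.sum_div,
          ← hA, ← hB, div_self hBpos.ne', mul_one, sub_self, add_zero]

/-- Each term of the entropy-like sum in `sum_mul_log_sum_div_le` is nonnegative. -/
theorem mul_log_sum_div_nonneg {ι : Type*} [Fintype ι] (a : ι → ℝ) (ha : ∀ k, 0 ≤ a k) (k : ι) :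
    0 ≤ a k * Real.log ((∑ l, a l) / a k) := by
  rcases (ha k).eq_or_lt with h0 | h0
  · simp [← h0]
  · refine mul_nonneg h0.le (Real.log_nonneg ?_)
    rw [one_le_div h0]
    exact Finset.single_le_sum (fun l _ => ha l) (mem_univ k)

/-- Lemma D.1, minimization part: among all candidate LLR matrices
`λ̃_{kl} = s_k − s_l`, the LSEL functional is minimized by the true LLR matrix. -/
theorem lsel_nonparametric_minimization {X : Type*} [MeasurableSpace X]
    (μ : Measure X) (K : ℕ) (hK : 2 ≤ K)
    (p : Fin K → X → ℝ)
    (hmeas : ∀ k, Measurable (p k)) (hnn : ∀ k x, 0 ≤ p k x)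
    (hprob : ∀ k, ∫⁻ x, ENNReal.ofReal (p k x) ∂μ = 1)
    (hsupp : ∀ k l x, p k x = 0 ↔ p l x = 0)
    (s : X → Fin K → ℝ) (hs : Measurable s) :
    ((K : ℝ≥0∞))⁻¹ *
        ∑ k, ∫⁻ x in {x | 0 < p k x},
          ENNReal.ofReal (p k x * Real.log ((∑ l, p l x) / p k x)) ∂μ ≤
      ((K : ℝ≥0∞))⁻¹ *
        ∑ k, ∫⁻ x,
          ENNReal.ofReal (p k x *
            Real.log (1 + ∑ l ∈ univ.filter (· ≠ k), Real.exp (s x l - s x k))) ∂μ := by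
  have hsm (k : Fin K) : Measurable fun x => s x k := (measurable_pi_apply k).comp hs
  refine mul_le_mul_right ?_ _
  calc
    _ ≤ ∑ k, ∫⁻ x, ENNReal.ofReal (p k x * Real.log ((∑ l, p l x) / p k x)) ∂μ :=
      Finset.sum_le_sum fun k _ => setLIntegral_le_lintegral _ _
    _ = ∫⁻ x, ∑ k, ENNReal.ofReal (p k x * Real.log ((∑ l, p l x) / p k x)) ∂μ :=
      (lintegral_finsetSum _ fun k _ => by fun_prop).symm
    _ ≤ ∫⁻ x, ∑ k, ENNReal.ofReal (p k x *
          Real.log (1 + ∑ l ∈ univ.filter (· ≠ k), Real.exp (s x l - s x k))) ∂μ := by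
      refine lintegral_mono fun x => ?_
      rw [← ENNReal.ofReal_sum_of_nonneg fun k _ =>
          mul_log_sum_div_nonneg (fun l => p l x) (fun l => hnn l x) k,
        ← ENNReal.ofReal_sum_of_nonneg fun k _ => mul_nonneg (hnn k x) <| Real.log_nonneg <|
          le_add_of_nonneg_right <| Finset.sum_nonneg fun l _ => (Real.exp_pos _).le]
      simp_rw [one_add_sum_exp_sub]
      exact ENNReal.ofReal_le_ofReal <| sum_mul_log_sum_div_le (fun l => p l x)
        (fun l => Real.exp (s x l)) (fun l => hnn l x) fun l => Real.exp_pos _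
    _ = _ := lintegral_finsetSum _ fun k _ => by fun_prop
end

section
/- Non-parametric minimization for the logistic loss (the core of the consistency of the logistic loss, Appendix F.2): Let (X, 𝔐, μ) be a measure space and p, q : X → [0,∞) measurable probability densities with common support (p(x) = 0 ⟺ q(x) = 0). Then for every measurable f : X → ℝ, ∫_{{p>0}} [ p(x) log(1 + q(x)/p(x)) + q(x) log(1 + p(x)/q(x)) ] dμ(x) ≤ ∫ [ p(x) log(1 + exp(−f(x))) + q(x) log(1 + exp(f(x))) ] dμ(x); i.e., the pairwise logistic-loss functional is minimized by the true log-likelihood ratio f = log(p/q). -/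
open MeasureTheory
open scoped ENNReal

lemma mul_log_one_add_div_le {a b B : ℝ} (ha : 0 < a) (hb : 0 < b) (hB : 0 < B) :
    a * Real.log (1 + b / a) ≤ a * Real.log B + ((a + b) / B - a) := by
  have hA : 0 < 1 + b / a := by positivity
  have h := Real.log_le_sub_one_of_pos (div_pos hA hB)
  rw [Real.log_div hA.ne' hB.ne'] at h
  have h' := mul_le_mul_of_nonneg_left h ha.le
  have e : a * ((1 + b / a) / B - 1) = (a + b) / B - a := by
    field_simp
  linarith

/-- The pointwise logistic loss with positive weights `a`, `b` is minimized at `log (a / b)`. -/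
lemma logistic_loss_pointwise_le {a b : ℝ} (ha : 0 < a) (hb : 0 < b) (t : ℝ) :
    a * Real.log (1 + b / a) + b * Real.log (1 + a / b) ≤
      a * Real.log (1 + Real.exp (-t)) + b * Real.log (1 + Real.exp t) := by
  have h₁ := mul_log_one_add_div_le ha hb (B := 1 + Real.exp (-t)) (by positivity)
  have h₂ := mul_log_one_add_div_le hb ha (B := 1 + Real.exp t) (by positivity)
  have e : (a + b) / (1 + Real.exp (-t)) + (b + a) / (1 + Real.exp t) = a + b := by
    rw [Real.exp_neg]
    have := Real.exp_pos t
    field_simp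
    ring
  linarith

/-- Non-parametric minimization for the logistic loss: the pairwise logistic-loss
functional is minimized by the true log-likelihood ratio `f = log(p/q)`. -/
theorem logistic_nonparametric_minimization {X : Type*} [MeasurableSpace X]
    (μ : Measure X) (p q : X → ℝ)
    (hpm : Measurable p) (hqm : Measurable q)
    (hpn : ∀ x, 0 ≤ p x) (hqn : ∀ x, 0 ≤ q x)
    (hpprob : ∫⁻ x, ENNReal.ofReal (p x) ∂μ = 1)
    (hqprob : ∫⁻ x, ENNReal.ofReal (q x) ∂μ = 1)
    (hsupp : ∀ x, p x = 0 ↔ q x = 0)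
    (f : X → ℝ) (hf : Measurable f) :
    (∫⁻ x in {x | 0 < p x},
        ENNReal.ofReal
          (p x * Real.log (1 + q x / p x) + q x * Real.log (1 + p x / q x)) ∂μ) ≤
      ∫⁻ x,
        ENNReal.ofReal
          (p x * Real.log (1 + Real.exp (-f x)) +
            q x * Real.log (1 + Real.exp (f x))) ∂μ := by
  refine le_trans (setLIntegral_mono' (measurableSet_lt measurable_const hpm) fun x hx => ?_)
    (setLIntegral_le_lintegral _ _)
  have hq : 0 < q x := (hqn x).lt_of_ne' fun h => (ne_of_gt hx) ((hsupp x).2 h)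
  exact ENNReal.ofReal_le_ofReal (logistic_loss_pointwise_le hx hq (f x))
end
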